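/- arXiv:2405.04205 — 9 statements merged into one kernel-verified Lean document; each statement's English description precedes it below -/
import Mathlib

section
/- The map φ⁻¹ is a Darboux transformation for the non-standard symplectic structure of the Ablowitz-Ladik/Salerno models: for every (x,y) ∈ ℝ², letting D denote the total derivative (Jacobian matrix) of φ⁻¹ at (x,y) and (q,p) = φ⁻¹(x,y), one has Dᵀ · (1/(1+ν(q²+p²))) J · D = J. -/
open Matrix
/-- `σ(s) = √((exp s − 1)/s)` for `s ≠ 0`, `σ(0) = 1`. -/
noncomputable def sigmaFun (s : ℝ) : ℝ :=
  if s = 0 then 1 else Real.sqrt ((Real.exp s - 1) / s)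

/-- The Darboux map `φ⁻¹` on `ℝ²` (as `Fin 2 → ℝ`):
`φ⁻¹(x,y) = (x·σ(ν(x²+y²)), y·σ(ν(x²+y²)))`. -/
noncomputable def phiInv (ν : ℝ) (v : Fin 2 → ℝ) : Fin 2 → ℝ :=
  fun i => v i * sigmaFun (ν * ((v 0) ^ 2 + (v 1) ^ 2))

/-- The standard symplectic matrix `J = [[0,1],[−1,0]]`. -/
noncomputable def Jmat : Matrix (Fin 2) (Fin 2) ℝ := !![0, 1; -1, 0]

/-- The Jacobian matrix of `φ⁻¹` at `v`. -/
noncomputable def jacPhiInv (ν : ℝ) (v : Fin 2 → ℝ) : Matrix (Fin 2) (Fin 2) ℝ :=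
  Matrix.of fun i j => fderiv ℝ (fun w : Fin 2 → ℝ => phiInv ν w i) v (Pi.single j 1)

/-- `s ↦ (exp s - 1) / s`, extended by `1` at the origin, is positive. -/
theorem dslope_exp_zero_pos (s : ℝ) : 0 < dslope Real.exp 0 s := by
  rcases eq_or_ne s 0 with rfl | hs
  · simp [dslope_same]
  · rw [dslope_of_ne _ hs, slope_def_field, Real.exp_zero, sub_zero]
    rcases hs.lt_or_gt with h | h
    · exact div_pos_of_neg_of_neg (by simpa using h) h
    · exact div_pos (by simpa using h) h

theorem differentiable_dslope_exp_zero : Differentiable ℝ (dslope Real.exp 0) := by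
  intro s
  rcases eq_or_ne s 0 with rfl | hs
  · obtain ⟨p, hp⟩ := (analyticAt_rexp : AnalyticAt ℝ Real.exp 0)
    exact hp.has_fpower_series_dslope_fslope.analyticAt.differentiableAt
  · exact (differentiableAt_dslope_of_ne hs).2 Real.differentiableAt_exp

theorem sigmaFun_eq_sqrt_dslope (s : ℝ) : sigmaFun s = √(dslope Real.exp 0 s) := by
  rcases eq_or_ne s 0 with rfl | hs
  · simp [sigmaFun, dslope_same]
  · rw [sigmaFun, if_neg hs, dslope_of_ne _ hs, slope_def_field, Real.exp_zero, sub_zero]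

theorem differentiable_sigmaFun : Differentiable ℝ sigmaFun := by
  rw [funext sigmaFun_eq_sqrt_dslope]
  exact differentiable_dslope_exp_zero.sqrt fun s => (dslope_exp_zero_pos s).ne'

theorem mul_sigmaFun_sq (s : ℝ) : s * sigmaFun s ^ 2 = Real.exp s - 1 := by
  rw [sigmaFun_eq_sqrt_dslope, Real.sq_sqrt (dslope_exp_zero_pos s).le]
  simpa using sub_smul_dslope Real.exp 0 s

/-- Differentiating `s * σ(s)² = exp s - 1`. -/
theorem sigmaFun_sq_add_deriv (s : ℝ) :
    sigmaFun s ^ 2 + 2 * s * sigmaFun s * deriv sigmaFun s = Real.exp s := by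
  have h₁ := (hasDerivAt_id' s).mul ((differentiable_sigmaFun s).hasDerivAt.pow 2)
  have h₂ : HasDerivAt (fun s => s * sigmaFun s ^ 2) (Real.exp s) s := by
    rw [funext mul_sigmaFun_sq]
    exact (Real.hasDerivAt_exp s).sub_const 1
  have h := h₁.unique h₂
  simp only [Pi.pow_apply] at h
  rw [← h]
  push_cast
  ring

theorem jacPhiInv_apply (ν : ℝ) (v : Fin 2 → ℝ) (i j : Fin 2) :
    jacPhiInv ν v i j =
      (if i = j then 1 else 0) * sigmaFun (ν * (v 0 ^ 2 + v 1 ^ 2)) +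
        2 * ν * deriv sigmaFun (ν * (v 0 ^ 2 + v 1 ^ 2)) * v i * v j := by
  have hc (k : Fin 2) : HasFDerivAt (fun w : Fin 2 → ℝ => w k)
      (ContinuousLinearMap.proj k : (Fin 2 → ℝ) →L[ℝ] ℝ) v :=
    (ContinuousLinearMap.proj k : (Fin 2 → ℝ) →L[ℝ] ℝ).hasFDerivAt
  have hs := (((hc 0).pow 2).add ((hc 1).pow 2)).const_mul ν
  have h := (hc i).mul
    ((differentiable_sigmaFun (ν * (v 0 ^ 2 + v 1 ^ 2))).hasDerivAt.comp_hasFDerivAt v hs)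
  have h' : fderiv ℝ (fun w : Fin 2 → ℝ => phiInv ν w i) v = _ := h.fderiv
  rw [jacPhiInv, Matrix.of_apply, h']
  fin_cases i <;> fin_cases j <;> simp <;> ring

/-- `φ⁻¹` is a Darboux transformation: `Dᵀ · (1/(1+ν(q²+p²))) J · D = J`
where `D` is the Jacobian of `φ⁻¹` at `(x,y)` and `(q,p) = φ⁻¹(x,y)`. -/
theorem stmt0 (ν : ℝ) (hν : 0 < ν) (x y : ℝ) :
    (jacPhiInv ν ![x, y])ᵀ *
      ((1 / (1 + ν * ((phiInv ν ![x, y] 0) ^ 2 + (phiInv ν ![x, y] 1) ^ 2))) • Jmat) *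
      (jacPhiInv ν ![x, y]) = Jmat := by
  have hq : ν * (phiInv ν ![x, y] 0 ^ 2 + phiInv ν ![x, y] 1 ^ 2) =
      Real.exp (ν * (x ^ 2 + y ^ 2)) - 1 := by
    rw [← mul_sigmaFun_sq]
    simp only [phiInv, Matrix.cons_val_zero, Matrix.cons_val_one]
    ring
  have hd := sigmaFun_sq_add_deriv (ν * (x ^ 2 + y ^ 2))
  have he := (Real.exp_pos (ν * (x ^ 2 + y ^ 2))).ne'
  rw [hq, add_sub_cancel]
  ext i j
  fin_cases i <;> fin_cases j <;>
    simp [Matrix.mul_apply, Fin.sum_univ_two, Jmat, jacPhiInv_apply] <;>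
    field_simp
  · ring
  · linear_combination hd
  · linear_combination -hd
  · ring
end

section
/- The vector field a(q,p) = (1/2)·[ln(1+ν(q²+p²))/(ν(q²+p²)) − 1]·(−p, q) (extended by a(0,0) = (0,0)) is a vector potential for the deformation 2-form ω₀ − ω₁: writing a = (a₁, a₂), for every (q,p) ∈ ℝ² one has ∂a₁/∂p (q,p) − ∂a₂/∂q (q,p) = ν(q²+p²)/(1+ν(q²+p²)). -/
/-- The vector potential `a(q,p) = (1/2)·[ln(1+ν(q²+p²))/(ν(q²+p²)) − 1]·(−p, q)`,
extended by `a(0,0) = (0,0)`. -/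
noncomputable def aField (ν : ℝ) (v : ℝ × ℝ) : ℝ × ℝ :=
  if v = (0, 0) then (0, 0)
  else ((1 / 2) * (Real.log (1 + ν * (v.1 ^ 2 + v.2 ^ 2)) / (ν * (v.1 ^ 2 + v.2 ^ 2)) - 1) * (-v.2),
        (1 / 2) * (Real.log (1 + ν * (v.1 ^ 2 + v.2 ^ 2)) / (ν * (v.1 ^ 2 + v.2 ^ 2)) - 1) * v.1)

/-- The scalar component `f(x,y)` with `aField ν (q, p) = (-f(p,q), f(q,p))`. -/
noncomputable def aFieldScalar (ν x y : ℝ) : ℝ :=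
  (1 / 2) * (Real.log (1 + ν * (x ^ 2 + y ^ 2)) / (ν * (x ^ 2 + y ^ 2)) - 1) * x

theorem aField_fst (ν q p : ℝ) : (aField ν (q, p)).1 = -aFieldScalar ν p q := by
  unfold aField aFieldScalar
  split_ifs with h
  · simp_all
  · rw [add_comm (p ^ 2)]
    ring

theorem aField_snd (ν q p : ℝ) : (aField ν (q, p)).2 = aFieldScalar ν q p := by
  unfold aField aFieldScalar
  split_ifs with h
  · simp_all
  · rfl

theorem hasDerivAt_aFieldScalar_of_pos {ν x y : ℝ} (hs : 0 < ν * (x ^ 2 + y ^ 2)) :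
    HasDerivAt (fun t => aFieldScalar ν t y)
      ((1 / 2) * ((ν * (2 * x) / (1 + ν * (x ^ 2 + y ^ 2)) * (ν * (x ^ 2 + y ^ 2))
          - Real.log (1 + ν * (x ^ 2 + y ^ 2)) * (ν * (2 * x))) / (ν * (x ^ 2 + y ^ 2)) ^ 2) * x
        + (1 / 2) * (Real.log (1 + ν * (x ^ 2 + y ^ 2)) / (ν * (x ^ 2 + y ^ 2)) - 1)) x := by
  have h₁ : HasDerivAt (fun t : ℝ => ν * (t ^ 2 + y ^ 2)) (ν * (2 * x)) x := by
    simpa using (((hasDerivAt_id x).pow 2).add_const (y ^ 2)).const_mul ν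
  have h₂ := (h₁.const_add 1).log (by positivity)
  have h₃ := (((h₂.fun_div h₁ hs.ne').sub_const 1).const_mul (1 / 2)).fun_mul (hasDerivAt_id' x)
  rw [mul_one] at h₃
  exact h₃

theorem tendsto_log_one_add_div :
    Filter.Tendsto (fun s : ℝ => Real.log (1 + s) / s) (nhdsWithin 0 {0}ᶜ) (nhds 1) := by
  have h : HasDerivAt (fun s : ℝ => Real.log (1 + s)) 1 0 := by
    simpa using ((hasDerivAt_id (0 : ℝ)).const_add 1).log (by simp)
  refine (hasDerivAt_iff_tendsto_slope.mp h).congr fun s => ?_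
  simp [slope_def_field]

theorem hasDerivAt_aFieldScalar_zero {ν : ℝ} (hν : ν ≠ 0) :
    HasDerivAt (fun t => aFieldScalar ν t 0) 0 0 := by
  have h : Filter.Tendsto (fun t : ℝ => ν * t ^ 2) (nhdsWithin 0 {0}ᶜ) (nhdsWithin 0 {0}ᶜ) := by
    refine tendsto_nhdsWithin_iff.mpr ⟨?_, ?_⟩
    · have hc : Continuous fun t : ℝ => ν * t ^ 2 := by fun_prop
      simpa using (hc.tendsto 0).mono_left nhdsWithin_le_nhds
    · filter_upwards [self_mem_nhdsWithin] with t ht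
      exact mul_ne_zero hν (pow_ne_zero 2 ht)
  have h₁ := ((tendsto_log_one_add_div.comp h).sub_const 1).const_mul (1 / 2)
  rw [sub_self, mul_zero] at h₁
  refine hasDerivAt_iff_tendsto_slope.mpr (h₁.congr' ?_)
  filter_upwards [self_mem_nhdsWithin] with t ht
  have ht₀ : t ≠ 0 := ht
  simp [slope_def_field, aFieldScalar, ht₀]

/-- `a` is a vector potential for the deformation 2-form `ω₀ − ω₁`:
`∂a₁/∂p − ∂a₂/∂q = ν(q²+p²)/(1+ν(q²+p²))` for every `(q,p) ∈ ℝ²`. -/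
theorem stmt4 (ν : ℝ) (hν : 0 < ν) (q p : ℝ) :
    deriv (fun p' => (aField ν (q, p')).1) p - deriv (fun q' => (aField ν (q', p)).2) q
      = ν * (q ^ 2 + p ^ 2) / (1 + ν * (q ^ 2 + p ^ 2)) := by
  simp only [aField_fst, aField_snd, deriv.fun_neg]
  by_cases h : q = 0 ∧ p = 0
  · obtain ⟨rfl, rfl⟩ := h
    simp [(hasDerivAt_aFieldScalar_zero hν.ne').deriv]
  · have hr : 0 < q ^ 2 + p ^ 2 := by
      rcases not_and_or.mp h with h | h <;> positivity
    have hs : 0 < ν * (q ^ 2 + p ^ 2) := mul_pos hν hr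
    have hs' : 0 < ν * (p ^ 2 + q ^ 2) := by rwa [add_comm (p ^ 2)]
    rw [(hasDerivAt_aFieldScalar_of_pos hs).deriv, (hasDerivAt_aFieldScalar_of_pos hs').deriv,
      add_comm (p ^ 2)]
    have hs₁ : 1 + ν * (q ^ 2 + p ^ 2) ≠ 0 := by positivity
    generalize Real.log (1 + ν * (q ^ 2 + p ^ 2)) = L
    field_simp
    ring
end

section
/- The time-dependent vector field V_t(q,p) = χ(t, q²+p²)·(q,p), with χ(t,A) = (1+νA)/(2(1+tνA)) · [ln(1+νA)/(νA) − 1] for A > 0 and χ(t,0) = 0, solves Moser's equation for the interpolating family Ω_t: for every t ∈ [0,1] and every (q,p) ∈ ℝ², the matrix Ω_t(q,p) = t·J + (1−t)·(1/(1+ν(q²+p²)))·J is invertible and Ω_t(q,p)ᵀ · V_t(q,p) = a(q,p). -/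
open Matrix

/-- `χ(t,A) = (1+νA)/(2(1+tνA)) · [ln(1+νA)/(νA) − 1]` for `A ≠ 0`, `χ(t,0) = 0`. -/
noncomputable def chi (ν t A : ℝ) : ℝ :=
  if A = 0 then 0
  else (1 + ν * A) / (2 * (1 + t * ν * A)) * (Real.log (1 + ν * A) / (ν * A) - 1)

/-- The Moser vector field `V_t(q,p) = χ(t, q²+p²)·(q,p)`. -/
noncomputable def Vfield (ν t q p : ℝ) : ℝ × ℝ :=
  (chi ν t (q ^ 2 + p ^ 2) * q, chi ν t (q ^ 2 + p ^ 2) * p)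

/-- The interpolating family `Ω_t(q,p) = t·J + (1−t)·(1/(1+ν(q²+p²)))·J`. -/
noncomputable def OmegaT (ν t q p : ℝ) : Matrix (Fin 2) (Fin 2) ℝ :=
  t • Jmat + (1 - t) • ((1 / (1 + ν * (q ^ 2 + p ^ 2))) • Jmat)

theorem OmegaT_eq_smul {ν : ℝ} (hν : 0 < ν) (t q p : ℝ) :
    OmegaT ν t q p =
      ((1 + t * ν * (q ^ 2 + p ^ 2)) / (1 + ν * (q ^ 2 + p ^ 2))) • Jmat := by
  have h : 1 + ν * (q ^ 2 + p ^ 2) ≠ 0 := by positivity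
  rw [OmegaT, smul_smul, ← add_smul]
  congr 1
  field_simp
  ring

theorem Jmat_transpose_mulVec (x y : ℝ) : Jmatᵀ.mulVec ![x, y] = ![-y, x] := by
  ext i
  fin_cases i <;> simp [Jmat, Matrix.mulVec, dotProduct, Fin.sum_univ_two]

/-- `V_t` solves Moser's equation: for every `t ∈ [0,1]` and `(q,p) ∈ ℝ²`, the matrix
`Ω_t(q,p)` is invertible and `Ω_t(q,p)ᵀ · V_t(q,p) = a(q,p)`. -/
theorem stmt5 (ν : ℝ) (hν : 0 < ν) (t : ℝ) (ht : t ∈ Set.Icc (0 : ℝ) 1) (q p : ℝ) :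
    IsUnit (OmegaT ν t q p) ∧
    (OmegaT ν t q p)ᵀ.mulVec ![(Vfield ν t q p).1, (Vfield ν t q p).2]
      = ![(aField ν (q, p)).1, (aField ν (q, p)).2] := by
  have ht0 : 0 ≤ t := ht.1
  have h₁ : 1 + ν * (q ^ 2 + p ^ 2) ≠ 0 := by positivity
  have h₂ : 1 + t * ν * (q ^ 2 + p ^ 2) ≠ 0 := by positivity
  rw [OmegaT_eq_smul hν]
  constructor
  · rw [Matrix.isUnit_iff_isUnit_det, isUnit_iff_ne_zero, Matrix.det_smul]
    simp [Jmat, Matrix.det_fin_two_of, h₁, h₂]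
  · rw [Matrix.transpose_smul, Matrix.smul_mulVec, Jmat_transpose_mulVec]
    by_cases h : q ^ 2 + p ^ 2 = 0
    · have hq : q = 0 := by nlinarith [sq_nonneg q, sq_nonneg p]
      have hp : p = 0 := by nlinarith [sq_nonneg q, sq_nonneg p]
      simp [Vfield, aField, hq, hp]
    · have hqp : (q, p) ≠ (0, 0) := by
        rintro ⟨⟩
        simp at h
      have hcoef : (1 + t * ν * (q ^ 2 + p ^ 2)) / (1 + ν * (q ^ 2 + p ^ 2)) *
          chi ν t (q ^ 2 + p ^ 2) =
          1 / 2 * (Real.log (1 + ν * (q ^ 2 + p ^ 2)) / (ν * (q ^ 2 + p ^ 2)) - 1) := by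
        rw [chi, if_neg h, ← mul_assoc]
        congr 1
        field_simp
      simp only [Vfield, aField, if_neg hqp, ← hcoef, Matrix.smul_cons, Matrix.smul_empty,
        smul_eq_mul, mul_neg, mul_assoc]
end

section
/- The Moser vector field V_t is asymptotically cubic and satisfies a uniform cubic bound near the origin: there exists a constant C > 0 (independent of ν) such that for all ν > 0, all t ∈ [0,1], all ρ > 0 with νρ² ≤ 1, and all (q,p) ∈ ℝ² with ‖(q,p)‖ ≤ ρ, one has ‖V_t(q,p)‖ ≤ C·ν·ρ³. -/
/-- `|χ(t,A)| ≤ νA/2` for `A ≥ 0`, from `x/(1+x) ≤ ln(1+x) ≤ x`. -/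
theorem abs_chi_le {ν t A : ℝ} (hν : 0 < ν) (ht : 0 ≤ t) (hA : 0 ≤ A) :
    |chi ν t A| ≤ ν * A / 2 := by
  unfold chi
  split_ifs with h0
  · simp [h0]
  have hx : 0 < ν * A := mul_pos hν (lt_of_le_of_ne hA (Ne.symm h0))
  have htx : 0 ≤ t * ν * A := by positivity
  set x := ν * A
  have hlog_le : Real.log (1 + x) ≤ x := by
    have := Real.log_le_sub_one_of_pos (show 0 < 1 + x by linarith)
    linarith
  have hle_log : 1 - (1 + x)⁻¹ ≤ Real.log (1 + x) :=
    Real.one_sub_inv_le_log_of_pos (by linarith)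
  have hupper : Real.log (1 + x) / x - 1 ≤ 0 := by
    rw [sub_nonpos, div_le_one hx]
    exact hlog_le
  have hlower : -(x / (1 + x)) ≤ Real.log (1 + x) / x - 1 := by
    have h : (1 - (1 + x)⁻¹) / x ≤ Real.log (1 + x) / x := by gcongr
    have he : (1 - (1 + x)⁻¹) / x = 1 - x / (1 + x) := by
      field_simp
      ring
    linarith
  have hfactor : (1 + x) / (2 * (1 + t * ν * A)) ≤ (1 + x) / 2 := by
    gcongr
    linarith
  rw [abs_mul, abs_of_nonneg (by positivity), abs_of_nonpos hupper]
  calc (1 + x) / (2 * (1 + t * ν * A)) * -(Real.log (1 + x) / x - 1)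
      ≤ (1 + x) / 2 * (x / (1 + x)) :=
        mul_le_mul hfactor (by linarith) (by linarith) (by positivity)
    _ = x / 2 := by field_simp

/-- The Euclidean norm of `V_t(q,p)` is `|χ|` times that of `(q,p)`. -/
theorem sqrt_Vfield (ν t q p : ℝ) :
    Real.sqrt ((Vfield ν t q p).1 ^ 2 + (Vfield ν t q p).2 ^ 2) =
      |chi ν t (q ^ 2 + p ^ 2)| * Real.sqrt (q ^ 2 + p ^ 2) := by
  simp only [Vfield]
  rw [mul_pow, mul_pow, ← mul_add, Real.sqrt_mul (sq_nonneg _), Real.sqrt_sq_eq_abs]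

/-- Uniform cubic bound for the Moser vector field near the origin: there is `C > 0`
(independent of `ν`) such that for all `ν > 0`, `t ∈ [0,1]`, `ρ > 0` with `νρ² ≤ 1`,
and all `(q,p)` with `‖(q,p)‖ ≤ ρ`, one has `‖V_t(q,p)‖ ≤ C·ν·ρ³`. -/
theorem stmt8 :
    ∃ C > (0 : ℝ), ∀ ν : ℝ, 0 < ν → ∀ t ∈ Set.Icc (0 : ℝ) 1, ∀ ρ : ℝ, 0 < ρ →
      ν * ρ ^ 2 ≤ 1 → ∀ q p : ℝ, Real.sqrt (q ^ 2 + p ^ 2) ≤ ρ →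
        Real.sqrt ((Vfield ν t q p).1 ^ 2 + (Vfield ν t q p).2 ^ 2) ≤ C * ν * ρ ^ 3 := by
  refine ⟨1, one_pos, fun ν hν t ht ρ hρ _ q p hqp => ?_⟩
  have hA : 0 ≤ q ^ 2 + p ^ 2 := by positivity
  have hAρ : q ^ 2 + p ^ 2 ≤ ρ ^ 2 := (Real.sqrt_le_left hρ.le).mp hqp
  rw [sqrt_Vfield]
  calc |chi ν t (q ^ 2 + p ^ 2)| * Real.sqrt (q ^ 2 + p ^ 2)
      ≤ ν * ρ ^ 2 / 2 * ρ := by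
        refine mul_le_mul ((abs_chi_le hν ht.1 hA).trans ?_) hqp (Real.sqrt_nonneg _)
          (by positivity)
        gcongr
    _ ≤ 1 * ν * ρ ^ 3 := by
        have : 0 ≤ ν * ρ ^ 3 := by positivity
        linarith
end

section
/- The Moser vector field V_t admits the time-independent cubic leading-order expansion V_t ∼ −(ν/4)(q²+p²)·(q,p): there exists a constant C > 0 such that for all ν > 0, all t ∈ [0,1], and all (q,p) ∈ ℝ² with ν(q²+p²) ≤ 1/2, one has ‖V_t(q,p) + (ν/4)(q²+p²)·(q,p)‖ ≤ C·ν²·‖(q,p)‖⁵. -/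
/-- Second-order Taylor bound for the logarithm, in the form
`|ln(1+x)/x − 1 + x/2| ≤ 2x²`. -/
lemma abs_log_one_add_div_sub_le {x : ℝ} (hx : 0 < x) (hx' : x ≤ 1 / 2) :
    |Real.log (1 + x) / x - 1 + x / 2| ≤ 2 * x ^ 2 := by
  have h := Real.abs_log_sub_add_sum_range_le (x := -x)
    (by rw [abs_neg, abs_of_pos hx]; linarith) 2
  rw [abs_neg, abs_of_pos hx, sub_neg_eq_add] at h
  norm_num [Finset.sum_range_succ] at h
  have hb : x ^ 3 / (1 - x) ≤ 2 * x ^ 2 * x := by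
    rw [div_le_iff₀ (by linarith)]
    nlinarith [pow_pos hx 3]
  have he : Real.log (1 + x) / x - 1 + x / 2 = (-x + x ^ 2 / 2 + Real.log (1 + x)) / x := by
    field_simp
    ring
  rw [he, abs_div, abs_of_pos hx, div_le_iff₀ hx]
  exact h.trans hb

lemma abs_chi_add_le {ν t A : ℝ} (hν : 0 < ν) (ht : t ∈ Set.Icc (0 : ℝ) 1) (hA : 0 ≤ A)
    (h : ν * A ≤ 1 / 2) : |chi ν t A + ν / 4 * A| ≤ 2 * (ν * A) ^ 2 := by
  obtain ⟨ht0, ht1⟩ := ht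
  rcases hA.eq_or_lt with rfl | hA
  · simp [chi]
  rw [chi, if_neg hA.ne', mul_assoc t ν A, div_mul_eq_mul_div ν 4 A]
  have hx : 0 < ν * A := mul_pos hν hA
  generalize ν * A = x at *
  have hr := abs_log_one_add_div_sub_le hx h
  generalize Real.log (1 + x) / x - 1 = y at *
  have htx : 0 ≤ t * x := by positivity
  have hd : 0 < 1 + t * x := by linarith
  obtain ⟨s, hs⟩ : ∃ s, (1 + x) / (1 + t * x) = 1 + s := ⟨(1 + x) / (1 + t * x) - 1, by ring⟩
  have hs0 : 0 ≤ s := by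
    have : 1 ≤ (1 + x) / (1 + t * x) := by
      rw [le_div_iff₀ hd]
      nlinarith
    linarith
  have hsx : s ≤ x := by
    have : (1 + x) / (1 + t * x) ≤ 1 + x := div_le_self (by linarith) (by linarith)
    linarith
  have he : (1 + x) / (2 * (1 + t * x)) * y + x / 4 =
      (1 + s) / 2 * (y + x / 2) - s * x / 4 := by
    rw [mul_comm 2, ← div_div, hs]
    ring
  rw [he]
  calc |(1 + s) / 2 * (y + x / 2) - s * x / 4|
      ≤ |(1 + s) / 2 * (y + x / 2)| + |s * x / 4| := abs_sub _ _
    _ = (1 + s) / 2 * |y + x / 2| + s * x / 4 := by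
        rw [abs_mul, abs_of_nonneg (by positivity : 0 ≤ (1 + s) / 2),
          abs_of_nonneg (by positivity : 0 ≤ s * x / 4)]
    _ ≤ 3 / 4 * (2 * x ^ 2) + x * x / 4 := by
        have hs2 : (1 + s) / 2 ≤ 3 / 4 := by linarith
        gcongr ?_ + ?_
        · exact mul_le_mul hs2 hr (abs_nonneg _) (by norm_num)
        · gcongr
    _ ≤ 2 * x ^ 2 := by nlinarith [sq_nonneg x]

/-- Time-independent cubic leading-order expansion `V_t ∼ −(ν/4)(q²+p²)·(q,p)`:
there is `C > 0` such that for all `ν > 0`, `t ∈ [0,1]` and `(q,p)` with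
`ν(q²+p²) ≤ 1/2`, one has `‖V_t(q,p) + (ν/4)(q²+p²)·(q,p)‖ ≤ C·ν²·‖(q,p)‖⁵`. -/
theorem stmt9 :
    ∃ C > (0 : ℝ), ∀ ν : ℝ, 0 < ν → ∀ t ∈ Set.Icc (0 : ℝ) 1, ∀ q p : ℝ,
      ν * (q ^ 2 + p ^ 2) ≤ 1 / 2 →
        Real.sqrt (((Vfield ν t q p).1 + ν / 4 * (q ^ 2 + p ^ 2) * q) ^ 2 +
            ((Vfield ν t q p).2 + ν / 4 * (q ^ 2 + p ^ 2) * p) ^ 2)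
          ≤ C * ν ^ 2 * Real.sqrt (q ^ 2 + p ^ 2) ^ 5 := by
  refine ⟨2, two_pos, fun ν hν t ht q p h => ?_⟩
  have hA : 0 ≤ q ^ 2 + p ^ 2 := by positivity
  have hk := abs_chi_add_le hν ht hA h
  simp only [Vfield]
  rw [← add_mul, ← add_mul, mul_pow, mul_pow, ← mul_add, Real.sqrt_mul (sq_nonneg _),
    Real.sqrt_sq_eq_abs]
  calc |chi ν t (q ^ 2 + p ^ 2) + ν / 4 * (q ^ 2 + p ^ 2)| * √(q ^ 2 + p ^ 2)
      ≤ 2 * (ν * (q ^ 2 + p ^ 2)) ^ 2 * √(q ^ 2 + p ^ 2) := by gcongr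
    _ = 2 * (ν * √(q ^ 2 + p ^ 2) ^ 2) ^ 2 * √(q ^ 2 + p ^ 2) := by rw [Real.sq_sqrt hA]
    _ = 2 * ν ^ 2 * √(q ^ 2 + p ^ 2) ^ 5 := by ring
end

section
/- Uniqueness of the analytic solution of the Darboux ODE: if ϱ₀ > 0 and h : ℝ → ℝ is real-analytic on a neighborhood of [0, ϱ₀) and satisfies ϱ·h'(ϱ) + 2(1−ϱ²)·h(ϱ) − 2 = 0 for all ϱ ∈ (0, ϱ₀), then h(ϱ) = (exp(ϱ²) − 1)/ϱ² for every ϱ ∈ (0, ϱ₀) (and h(0) = 1). -/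
/-- Uniqueness of the analytic solution of the Darboux ODE: if `h` is real-analytic
on a neighborhood of `[0, ϱ₀)` and satisfies `ϱ·h'(ϱ) + 2(1−ϱ²)·h(ϱ) − 2 = 0` on
`(0, ϱ₀)`, then `h(ϱ) = (exp(ϱ²) − 1)/ϱ²` on `(0, ϱ₀)` and `h(0) = 1`. -/
theorem stmt11 (ϱ₀ : ℝ) (hϱ₀ : 0 < ϱ₀) (h : ℝ → ℝ)
    (han : AnalyticOnNhd ℝ h (Set.Ico 0 ϱ₀))
    (hode : ∀ ϱ ∈ Set.Ioo 0 ϱ₀, ϱ * deriv h ϱ + 2 * (1 - ϱ ^ 2) * h ϱ - 2 = 0) :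
    (∀ ϱ ∈ Set.Ioo 0 ϱ₀, h ϱ = (Real.exp (ϱ ^ 2) - 1) / ϱ ^ 2) ∧ h 0 = 1 := by
  have h_zero_mem : (0 : ℝ) ∈ Set.Ico 0 ϱ₀ := ⟨le_rfl, hϱ₀⟩
  refine ⟨fun ϱ hϱ => ?_, ?_⟩
  · have hG : ∀ x ∈ Set.Ico 0 ϱ₀, HasDerivAt
        (fun t => Real.exp (-t ^ 2) * (t ^ 2 * h t + 1)) 0 x := by
      intro x hx
      have hh := (han x hx).differentiableAt.hasDerivAt
      have hexp := ((hasDerivAt_pow 2 x).neg).exp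
      have hprod := hexp.mul (((hasDerivAt_pow 2 x).mul hh).add_const 1)
      refine hprod.congr_deriv ?_
      rcases hx.1.eq_or_lt with rfl | hpos
      · simp
      · have hx_ode := hode x ⟨hpos, hx.2⟩
        simp only [Pi.neg_apply, Pi.mul_apply, Nat.cast_ofNat, Nat.add_one_sub_one, pow_one]
        linear_combination Real.exp (-x ^ 2) * x * hx_ode
    have hconst := constant_of_has_deriv_right_zero
      (f := fun t => Real.exp (-t ^ 2) * (t ^ 2 * h t + 1)) (a := 0) (b := ϱ)
      (fun x hx => (hG x ⟨hx.1, hx.2.trans_lt hϱ.2⟩).continuousAt.continuousWithinAt)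
      (fun x hx => (hG x ⟨hx.1, hx.2.trans hϱ.2⟩).hasDerivWithinAt)
      ϱ ⟨hϱ.1.le, le_rfl⟩
    have hval : Real.exp (-ϱ ^ 2) * (ϱ ^ 2 * h ϱ + 1) = 1 := by simpa using hconst
    have hinv : Real.exp (ϱ ^ 2) * Real.exp (-ϱ ^ 2) = 1 := by
      rw [← Real.exp_add, add_neg_cancel, Real.exp_zero]
    rw [eq_div_iff (pow_ne_zero 2 hϱ.1.ne')]
    linear_combination Real.exp (ϱ ^ 2) * hval - (ϱ ^ 2 * h ϱ + 1) * hinv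
  · have hcont : ContinuousAt
        (fun x => x * deriv h x + 2 * (1 - x ^ 2) * h x - 2) 0 := by
      have hc := (han 0 h_zero_mem).continuousAt
      have hd := (han 0 h_zero_mem).deriv.continuousAt
      fun_prop
    have hlim := hcont.tendsto.mono_left (nhdsWithin_le_nhds (s := Set.Ioi 0))
    have hev : (fun _ => (0 : ℝ)) =ᶠ[nhdsWithin 0 (Set.Ioi 0)]
        (fun x => x * deriv h x + 2 * (1 - x ^ 2) * h x - 2) := by
      filter_upwards [Ioo_mem_nhdsGT hϱ₀] with x hx using (hode x hx).symm
    have heq := tendsto_nhds_unique (tendsto_const_nhds.congr' hev) hlim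
    norm_num at heq
    linarith
end

section
/- dNLS normal form for the Ablowitz-Ladik model: there exist constants C₀' > 0 and ρ₀ > 0 (depending on ν, N) such that for all 0 < ρ ≤ ρ₀ and all ε ∈ (0,1], the transformed Ablowitz-Ladik Hamiltonian K = H ∘ Φ (the case γ = 0) satisfies sup over the ball {(x,y) ∈ ℝ^N×ℝ^N : ‖(x,y)‖ ≤ ρ} of |K(x,y) − Z(x,y)| ≤ C₀' · ρ⁴ · (1 + ε), where Z(x,y) = ε·Σ_j (x_{j+1}x_j + y_{j+1}y_j). -/
/-- The Ablowitz-Ladik Hamiltonian in Cartesian coordinates on the periodic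
lattice `ℤ/N` (the case `γ = 0` of the Salerno model). -/
noncomputable def alH (ε : ℝ) (N : ℕ) [NeZero N] (q p : ZMod N → ℝ) : ℝ :=
  ε * ∑ j : ZMod N, (q (j + 1) * q j + p (j + 1) * p j)

/-- The componentwise Darboux transformation `Φ`, first component `q_j`. -/
noncomputable def Qmap (ν : ℝ) {N : ℕ} (x y : ZMod N → ℝ) : ZMod N → ℝ :=
  fun j => x j * sigmaFun (ν * ((x j) ^ 2 + (y j) ^ 2))

/-- The componentwise Darboux transformation `Φ`, second component `p_j`. -/
noncomputable def Pmap (ν : ℝ) {N : ℕ} (x y : ZMod N → ℝ) : ZMod N → ℝ :=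
  fun j => y j * sigmaFun (ν * ((x j) ^ 2 + (y j) ^ 2))

/-- The dNLS hopping Hamiltonian `Z`. -/
noncomputable def Zhop (ε : ℝ) (N : ℕ) [NeZero N] (x y : ZMod N → ℝ) : ℝ :=
  ε * ∑ j : ZMod N, (x (j + 1) * x j + y (j + 1) * y j)

/-- On `[0, 1]` the function `σ` satisfies `1 ≤ σ(s) ≤ 1 + s`. -/
theorem sigmaFun_mem_Icc {s : ℝ} (h0 : 0 ≤ s) (h1 : s ≤ 1) :
    sigmaFun s ∈ Set.Icc 1 (1 + s) := by
  unfold sigmaFun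
  split_ifs with h
  · simp [h]
  have hs : 0 < s := lt_of_le_of_ne h0 (Ne.symm h)
  have hexp := abs_le.1 (Real.abs_exp_sub_one_sub_id_le (abs_le.2 ⟨by linarith, h1⟩))
  constructor
  · rw [Real.one_le_sqrt, le_div_iff₀ hs]
    linarith [Real.add_one_le_exp s]
  · refine Real.sqrt_le_iff.2 ⟨by linarith, ?_⟩
    rw [div_le_iff₀ hs]
    nlinarith [mul_nonneg h0 h0, mul_nonneg (mul_nonneg h0 h0) h0]

/-- If `σ, τ ∈ [1, 1 + δ]` with `0 ≤ δ ≤ 1`, then rescaling two plane vectors by `σ` and `τ`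
changes their inner product by at most `3δ` times the mean of their squared norms. -/
theorem abs_scaled_inner_sub_le {a b c d σ τ δ : ℝ} (hδ : δ ≤ 1)
    (hσ : σ ∈ Set.Icc 1 (1 + δ)) (hτ : τ ∈ Set.Icc 1 (1 + δ)) :
    |(a * σ * (c * τ) + b * σ * (d * τ)) - (a * c + b * d)|
      ≤ 3 * δ * (((a ^ 2 + b ^ 2) + (c ^ 2 + d ^ 2)) / 2) := by
  obtain ⟨hσ1, hσ2⟩ := hσ
  obtain ⟨hτ1, hτ2⟩ := hτ
  have hlow : 0 ≤ σ * τ - 1 := by nlinarith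
  have hupp : σ * τ - 1 ≤ 3 * δ := by nlinarith
  have hinner : |a * c + b * d| ≤ ((a ^ 2 + b ^ 2) + (c ^ 2 + d ^ 2)) / 2 :=
    abs_le.2 ⟨by nlinarith [sq_nonneg (a + c), sq_nonneg (b + d)],
      by nlinarith [sq_nonneg (a - c), sq_nonneg (b - d)]⟩
  calc |(a * σ * (c * τ) + b * σ * (d * τ)) - (a * c + b * d)|
      = (σ * τ - 1) * |a * c + b * d| := by
        rw [← abs_of_nonneg hlow, ← abs_mul]
        congr 1
        ring
    _ ≤ _ := mul_le_mul hupp hinner (abs_nonneg _) (hlow.trans hupp)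

/-- dNLS normal form of the Ablowitz-Ladik model: `|H∘Φ − Z| ≤ C₀'·ρ⁴·(1+ε)` on the
ball of radius `ρ ≤ ρ₀`, for all `ε ∈ (0,1]`. -/
theorem stmt14 (ν : ℝ) (hν : 0 < ν) (N : ℕ) [NeZero N] (hN : 2 ≤ N) :
    ∃ C₀' > (0 : ℝ), ∃ ρ₀ > (0 : ℝ), ∀ ρ : ℝ, 0 < ρ → ρ ≤ ρ₀ →
      ∀ ε : ℝ, 0 < ε → ε ≤ 1 →
        ∀ x y : ZMod N → ℝ, Real.sqrt (∑ j : ZMod N, ((x j) ^ 2 + (y j) ^ 2)) ≤ ρ →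
          |alH ε N (Qmap ν x y) (Pmap ν x y) - Zhop ε N x y|
            ≤ C₀' * ρ ^ 4 * (1 + ε) := by
  refine ⟨3 * ν, by positivity, 1 / (1 + ν), by positivity, ?_⟩
  intro ρ hρ hρ₀ ε hε hε1 x y hxy
  set r : ZMod N → ℝ := fun j => (x j) ^ 2 + (y j) ^ 2
  have hr0 : ∀ j, 0 ≤ r j := fun j => by positivity
  have hsum : ∑ j, r j ≤ ρ ^ 2 := (Real.sqrt_le_left hρ.le).1 hxy
  have hδ : ν * ρ ^ 2 ≤ 1 := by
    have h := (le_div_iff₀ (by positivity)).1 hρ₀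
    nlinarith [mul_pos hρ hν]
  have hσ : ∀ j, sigmaFun (ν * r j) ∈ Set.Icc 1 (1 + ν * ρ ^ 2) := fun j => by
    have hj : ν * r j ≤ ν * ρ ^ 2 := mul_le_mul_of_nonneg_left
      ((Finset.single_le_sum (fun i _ => hr0 i) (Finset.mem_univ j)).trans hsum) hν.le
    exact Set.Icc_subset_Icc_right (by linarith)
      (sigmaFun_mem_Icc (mul_nonneg hν.le (hr0 j)) (hj.trans hδ))
  have hshift : ∑ j, r (j + 1) = ∑ j, r j := Equiv.sum_comp (Equiv.addRight 1) r
  have hbound : |∑ j, ((Qmap ν x y (j + 1) * Qmap ν x y j + Pmap ν x y (j + 1) * Pmap ν x y j)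
      - (x (j + 1) * x j + y (j + 1) * y j))| ≤ 3 * ν * ρ ^ 4 := by
    calc _ ≤ ∑ j, 3 * (ν * ρ ^ 2) * ((r (j + 1) + r j) / 2) :=
          (Finset.abs_sum_le_sum_abs _ _).trans (Finset.sum_le_sum fun j _ =>
            abs_scaled_inner_sub_le hδ (hσ (j + 1)) (hσ j))
      _ = 3 * (ν * ρ ^ 2) * ∑ j, r j := by
          rw [← Finset.mul_sum, ← Finset.sum_div, Finset.sum_add_distrib, hshift]
          ring
      _ ≤ 3 * (ν * ρ ^ 2) * ρ ^ 2 := by gcongr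
      _ = 3 * ν * ρ ^ 4 := by ring
  unfold alH Zhop
  rw [← mul_sub, ← Finset.sum_sub_distrib, abs_mul, abs_of_pos hε]
  calc _ ≤ ε * (3 * ν * ρ ^ 4) := by gcongr
    _ ≤ 3 * ν * ρ ^ 4 * (1 + ε) := by nlinarith [show 0 < 3 * ν * ρ ^ 4 by positivity]
end

section
/- Convergence rate of the truncated Lie series of the conserved quantity P: for every integer K ≥ 1 there exist constants C > 0 and c > 0 (depending on K) such that for every ν > 0 and every ρ > 0 with νρ² ≤ c, one has sup over {(x,y) ∈ ℝ² : x²+y² ≤ ρ²} of |(x²+y²)/2 − Σ_{k=0}^{K} ((−1)^k / k!)·(L^k P̃)(1, x, y)| ≤ C · ν^{K+1} · ρ^{2K+4}. -/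
/-- The Lie derivative along the extended vector field `Ṽ = (1, V_τ)`, with
`V_τ(q,p) = χ(τ, q²+p²)·(q,p)`, acting on functions of `(τ,q,p) ∈ ℝ³`:
`(L f)(τ,q,p) = ∂f/∂τ + V_τ(q,p)·∇_{(q,p)} f`. -/
noncomputable def LieD (ν : ℝ) (f : ℝ × ℝ × ℝ → ℝ) : ℝ × ℝ × ℝ → ℝ :=
  fun z => fderiv ℝ f z
    (1, chi ν z.1 (z.2.1 ^ 2 + z.2.2 ^ 2) * z.2.1,
        chi ν z.1 (z.2.1 ^ 2 + z.2.2 ^ 2) * z.2.2)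

/-- The time-independent extension `P̃(τ,q,p) = (1/(2ν))·ln(1+ν(q²+p²))`. -/
noncomputable def Ptilde (ν : ℝ) (z : ℝ × ℝ × ℝ) : ℝ :=
  (1 / (2 * ν)) * Real.log (1 + ν * (z.2.1 ^ 2 + z.2.2 ^ 2))

/-- The radial speed `du/dt` of the flow of `V` in the variable `u = ν(q²+p²)`. -/
noncomputable def radialSpeed (z : ℝ × ℝ) : ℝ :=
  (1 + z.2) / (1 + z.1 * z.2) * (Real.log (1 + z.2) - z.2)

/-- The Lie derivative in the variables `(t, u)` with `u = ν(q²+p²)`. -/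
noncomputable def radialLie (f : ℝ × ℝ → ℝ) (z : ℝ × ℝ) : ℝ :=
  fderiv ℝ f z (1, radialSpeed z)

/-- The function `P` in the variables `(t, u)`, multiplied by `ν`. -/
noncomputable def radialLog (z : ℝ × ℝ) : ℝ := Real.log (1 + z.2) / 2

/-- The open set on which the radial Lie derivative is regular. -/
def radialDomain : Set (ℝ × ℝ) := {z | 0 < z.2 ∧ 0 < 1 + z.1 * z.2}

/-- `f` is differentiable at `z`, with derivative `d` along `(1, radialSpeed z)`. -/
def HasRadialDeriv (f : ℝ × ℝ → ℝ) (d : ℝ) (z : ℝ × ℝ) : Prop :=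
  ∃ f' : ℝ × ℝ →L[ℝ] ℝ, HasFDerivAt f f' z ∧ f' (1, radialSpeed z) = d

/-- The normalized remainder `(ln(1+u) − u)/u²`. -/
noncomputable def logRemainder (u : ℝ) : ℝ := (Real.log (1 + u) - u) / u ^ 2

/-- The algebra of functions generated by `u`, `tu`, `(ln(1+u) − u)/u²`, `1/(1+u)` and
`1/(1+tu)`. -/
noncomputable def radialAlgebra : Subalgebra ℝ (ℝ × ℝ → ℝ) :=
  Algebra.adjoin ℝ {fun z => z.2, fun z => z.1 * z.2, fun z => logRemainder z.2,
    fun z => (1 + z.2)⁻¹, fun z => (1 + z.1 * z.2)⁻¹}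

lemma isOpen_radialDomain : IsOpen radialDomain := by
  have h1 : IsOpen {z : ℝ × ℝ | 0 < z.2} := isOpen_lt continuous_const continuous_snd
  have h2 : IsOpen {z : ℝ × ℝ | 0 < 1 + z.1 * z.2} := isOpen_lt continuous_const (by fun_prop)
  exact h1.inter h2

namespace HasRadialDeriv

variable {f g : ℝ × ℝ → ℝ} {d e : ℝ} {z : ℝ × ℝ}

lemma radialLie_eq (hf : HasRadialDeriv f d z) : radialLie f z = d := by
  obtain ⟨f', h, rfl⟩ := hf
  rw [radialLie, h.fderiv]

lemma congr_deriv (hf : HasRadialDeriv f d z) (h : d = e) : HasRadialDeriv f e z :=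
  h ▸ hf

lemma congr_of_mem (hf : HasRadialDeriv f d z) (hz : z ∈ radialDomain)
    (h : ∀ z ∈ radialDomain, g z = f z) : HasRadialDeriv g d z := by
  obtain ⟨f', hf', hd⟩ := hf
  refine ⟨f', hf'.congr_of_eventuallyEq ?_, hd⟩
  filter_upwards [isOpen_radialDomain.mem_nhds hz] with y hy using h y hy

lemma add (hf : HasRadialDeriv f d z) (hg : HasRadialDeriv g e z) :
    HasRadialDeriv (f + g) (d + e) z := by
  obtain ⟨f', hf', rfl⟩ := hf
  obtain ⟨g', hg', rfl⟩ := hg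
  exact ⟨_, hf'.add hg', rfl⟩

lemma mul (hf : HasRadialDeriv f d z) (hg : HasRadialDeriv g e z) :
    HasRadialDeriv (f * g) (f z * e + g z * d) z := by
  obtain ⟨f', hf', rfl⟩ := hf
  obtain ⟨g', hg', rfl⟩ := hg
  exact ⟨_, hf'.mul hg', rfl⟩

lemma comp {φ : ℝ → ℝ} {φ' : ℝ} (hf : HasRadialDeriv f d z) (hφ : HasDerivAt φ φ' (f z)) :
    HasRadialDeriv (fun z => φ (f z)) (φ' * d) z := by
  obtain ⟨f', hf', rfl⟩ := hf
  exact ⟨_, hφ.comp_hasFDerivAt z hf', rfl⟩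

lemma const (c : ℝ) : HasRadialDeriv (fun _ => c) 0 z :=
  ⟨0, hasFDerivAt_const c z, rfl⟩

lemma fst : HasRadialDeriv (fun z => z.1) 1 z :=
  ⟨_, hasFDerivAt_fst, rfl⟩

lemma snd : HasRadialDeriv (fun z => z.2) (radialSpeed z) z :=
  ⟨_, hasFDerivAt_snd, rfl⟩

end HasRadialDeriv

lemma radialSpeed_eq {z : ℝ × ℝ} (hz : 0 < z.2) :
    radialSpeed z = z.2 * (z.2 * ((1 + z.2) * logRemainder z.2 * (1 + z.1 * z.2)⁻¹)) := by
  unfold radialSpeed logRemainder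
  field_simp

lemma hasDerivAt_logRemainder {u : ℝ} (hu : 0 < u) :
    HasDerivAt logRemainder ((-(1 + u)⁻¹ - 2 * logRemainder u) / u) u := by
  have h1 : HasDerivAt (fun u : ℝ => 1 + u) 1 u := (hasDerivAt_id u).const_add 1
  have h : HasDerivAt logRemainder _ u :=
    ((h1.log (by positivity)).sub (hasDerivAt_id u)).div (hasDerivAt_pow 2 u) (by positivity)
  convert h using 1
  have : 1 + u ≠ 0 := by positivity
  simp only [logRemainder, id, Pi.sub_apply]
  field_simp
  ring

lemma hasDerivAt_one_add_inv {v : ℝ} (hv : 0 < 1 + v) :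
    HasDerivAt (fun v : ℝ => (1 + v)⁻¹) (-((1 + v)⁻¹ * (1 + v)⁻¹)) v := by
  refine (((hasDerivAt_id v).const_add 1).inv hv.ne').congr_deriv ?_
  rw [id, ← mul_inv, ← sq, neg_div, one_div]

lemma snd_mem_radialAlgebra : (fun z => z.2) ∈ radialAlgebra :=
  Algebra.subset_adjoin (by simp)

lemma mul_mem_radialAlgebra : (fun z => z.1 * z.2) ∈ radialAlgebra :=
  Algebra.subset_adjoin (by simp)

lemma logRemainder_mem_radialAlgebra : (fun z => logRemainder z.2) ∈ radialAlgebra :=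
  Algebra.subset_adjoin (by simp)

lemma inv_one_add_snd_mem_radialAlgebra : (fun z => (1 + z.2)⁻¹) ∈ radialAlgebra :=
  Algebra.subset_adjoin (by simp)

lemma inv_one_add_mul_mem_radialAlgebra : (fun z => (1 + z.1 * z.2)⁻¹) ∈ radialAlgebra :=
  Algebra.subset_adjoin (by simp)

/-- The function `radialSpeed z / u²`. -/
lemma speedFactor_mem_radialAlgebra :
    (fun z => (1 + z.2) * logRemainder z.2 * (1 + z.1 * z.2)⁻¹) ∈ radialAlgebra :=
  mul_mem (mul_mem (add_mem (one_mem _) snd_mem_radialAlgebra) logRemainder_mem_radialAlgebra)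
    inv_one_add_mul_mem_radialAlgebra

lemma exists_hasRadialDeriv_of_mem {f : ℝ × ℝ → ℝ} (hf : f ∈ radialAlgebra) :
    ∃ g ∈ radialAlgebra, ∀ z ∈ radialDomain, HasRadialDeriv f (z.2 * g z) z := by
  set η : ℝ × ℝ → ℝ := fun z => (1 + z.2) * logRemainder z.2 * (1 + z.1 * z.2)⁻¹ with hη
  have hηm : η ∈ radialAlgebra := speedFactor_mem_radialAlgebra
  have hspeed : ∀ z ∈ radialDomain, radialSpeed z = z.2 * (z.2 * η z) :=
    fun z hz => radialSpeed_eq hz.1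
  have hmul : ∀ z ∈ radialDomain,
      HasRadialDeriv (fun z => z.1 * z.2) (z.2 * (1 + z.1 * z.2 * η z)) z := by
    intro z hz
    refine (HasRadialDeriv.fst.mul HasRadialDeriv.snd).congr_deriv ?_
    rw [hspeed z hz]
    ring
  have hmulm : (1 + (fun z => z.1 * z.2) * η) ∈ radialAlgebra :=
    add_mem (one_mem _) (mul_mem mul_mem_radialAlgebra hηm)
  induction hf using Algebra.adjoin_induction with
  | mem f hf =>
    rcases hf with rfl | rfl | rfl | rfl | rfl
    · refine ⟨_, mul_mem snd_mem_radialAlgebra hηm, fun z hz => ?_⟩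
      convert HasRadialDeriv.snd using 1
      exact (hspeed z hz).symm
    · exact ⟨_, hmulm, hmul⟩
    · refine ⟨_, mul_mem hηm (sub_mem (neg_mem inv_one_add_snd_mem_radialAlgebra)
        (add_mem logRemainder_mem_radialAlgebra logRemainder_mem_radialAlgebra)), fun z hz => ?_⟩
      convert HasRadialDeriv.snd.comp (hasDerivAt_logRemainder hz.1) using 1
      have := hz.1
      rw [hspeed z hz]
      simp only [Pi.mul_apply, Pi.sub_apply, Pi.neg_apply, Pi.add_apply]
      field_simp
      ring
    · refine ⟨_, neg_mem (mul_mem (mul_mem inv_one_add_snd_mem_radialAlgebra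
        inv_one_add_snd_mem_radialAlgebra) (mul_mem snd_mem_radialAlgebra hηm)), fun z hz => ?_⟩
      convert HasRadialDeriv.snd.comp (hasDerivAt_one_add_inv (by linarith [hz.1])) using 1
      rw [hspeed z hz]
      simp only [Pi.mul_apply, Pi.neg_apply]
      ring
    · refine ⟨_, neg_mem (mul_mem (mul_mem inv_one_add_mul_mem_radialAlgebra
        inv_one_add_mul_mem_radialAlgebra) hmulm), fun z hz => ?_⟩
      convert (hmul z hz).comp (hasDerivAt_one_add_inv hz.2) using 1
      simp only [Pi.mul_apply, Pi.neg_apply, Pi.add_apply, Pi.one_apply]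
      ring
  | algebraMap r =>
    refine ⟨0, zero_mem _, fun z _ => ?_⟩
    refine (HasRadialDeriv.const r).congr_deriv ?_
    simp
  | add f g _ _ hf hg =>
    obtain ⟨f', hf'm, hf'⟩ := hf
    obtain ⟨g', hg'm, hg'⟩ := hg
    refine ⟨_, add_mem hf'm hg'm, fun z hz => ?_⟩
    convert (hf' z hz).add (hg' z hz) using 1
    simp only [Pi.add_apply]
    ring
  | mul f g hfm hgm hf hg =>
    obtain ⟨f', hf'm, hf'⟩ := hf
    obtain ⟨g', hg'm, hg'⟩ := hg
    refine ⟨_, add_mem (mul_mem hfm hg'm) (mul_mem hgm hf'm), fun z hz => ?_⟩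
    convert (hf' z hz).mul (hg' z hz) using 1
    simp only [Pi.add_apply, Pi.mul_apply]
    ring

lemma abs_logRemainder_le_one {u : ℝ} (hu : 0 < u) : |logRemainder u| ≤ 1 := by
  have h1 := Real.log_le_sub_one_of_pos (show 0 < 1 + u by linarith)
  have h2 := Real.one_sub_inv_le_log_of_pos (show 0 < 1 + u by linarith)
  have h3 : u - u ^ 2 ≤ 1 - (1 + u)⁻¹ := by
    have : 1 - (1 + u)⁻¹ = u / (1 + u) := by field_simp; ring
    rw [this, le_div_iff₀ (by positivity)]
    nlinarith [pow_pos hu 3]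
  rw [logRemainder, abs_div, abs_of_pos (pow_pos hu 2), div_le_one (pow_pos hu 2), abs_le]
  constructor <;> nlinarith [sq_nonneg u]

lemma exists_abs_le_of_mem {f : ℝ × ℝ → ℝ} (hf : f ∈ radialAlgebra) :
    ∃ C, 0 ≤ C ∧ ∀ t u : ℝ, 0 ≤ t → t ≤ 1 → 0 < u → u ≤ 2 → |f (t, u)| ≤ C := by
  induction hf using Algebra.adjoin_induction with
  | mem f hf =>
    refine ⟨2, by norm_num, fun t u ht0 ht1 hu0 hu2 => ?_⟩
    have htu : 0 ≤ t * u := by positivity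
    rcases hf with rfl | rfl | rfl | rfl | rfl
    · simpa [abs_of_pos hu0] using hu2
    · simp only [abs_of_nonneg htu]
      nlinarith
    · linarith [abs_logRemainder_le_one hu0]
    · have := inv_le_one_of_one_le₀ (show 1 ≤ 1 + u by linarith)
      have h : 0 < (1 + u)⁻¹ := by positivity
      simp only [abs_of_pos h]
      linarith
    · have := inv_le_one_of_one_le₀ (show 1 ≤ 1 + t * u by linarith)
      have h : 0 < (1 + t * u)⁻¹ := by positivity
      simp only [abs_of_pos h]
      linarith
  | algebraMap r => exact ⟨|r|, abs_nonneg r, fun _ _ _ _ _ _ => le_rfl⟩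
  | add f g _ _ hf hg =>
    obtain ⟨C, hC, hf⟩ := hf
    obtain ⟨C', hC', hg⟩ := hg
    exact ⟨C + C', add_nonneg hC hC', fun t u h1 h2 h3 h4 =>
      (abs_add_le _ _).trans (add_le_add (hf t u h1 h2 h3 h4) (hg t u h1 h2 h3 h4))⟩
  | mul f g _ _ hf hg =>
    obtain ⟨C, hC, hf⟩ := hf
    obtain ⟨C', hC', hg⟩ := hg
    refine ⟨C * C', mul_nonneg hC hC', fun t u h1 h2 h3 h4 => ?_⟩
    rw [Pi.mul_apply, abs_mul]
    exact mul_le_mul (hf t u h1 h2 h3 h4) (hg t u h1 h2 h3 h4) (abs_nonneg _) hC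

lemma hasRadialDeriv_radialLog {z : ℝ × ℝ} (hz : z ∈ radialDomain) :
    HasRadialDeriv radialLog (z.2 ^ 2 * (2⁻¹ * (logRemainder z.2 * (1 + z.1 * z.2)⁻¹))) z := by
  have h1 : HasDerivAt (fun u : ℝ => Real.log (1 + u) / 2) (1 / (1 + z.2) / 2) z.2 :=
    (((hasDerivAt_id z.2).const_add 1).log (by linarith [hz.1, id_eq z.2])).div_const 2
  refine (HasRadialDeriv.snd.comp h1).congr_deriv ?_
  have := hz.1
  have : 1 + z.2 ≠ 0 := by positivity
  rw [radialSpeed_eq hz.1]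
  field_simp

lemma exists_iterate_radialLie_eq (k : ℕ) :
    ∃ f ∈ radialAlgebra, ∀ z ∈ radialDomain,
      radialLie^[k + 1] radialLog z = z.2 ^ (k + 2) * f z := by
  induction k with
  | zero =>
    refine ⟨_, Subalgebra.smul_mem _ (mul_mem logRemainder_mem_radialAlgebra
      inv_one_add_mul_mem_radialAlgebra) (2⁻¹ : ℝ), fun z hz => ?_⟩
    exact (hasRadialDeriv_radialLog hz).radialLie_eq
  | succ k ih =>
    obtain ⟨f, hfm, hf⟩ := ih
    obtain ⟨g, hgm, hg⟩ := exists_hasRadialDeriv_of_mem hfm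
    refine ⟨_, add_mem hgm (Subalgebra.smul_mem _ (mul_mem hfm speedFactor_mem_radialAlgebra)
      (k + 2 : ℝ)), fun z hz => ?_⟩
    have h := ((HasRadialDeriv.snd.comp (hasDerivAt_pow (k + 2) z.2)).mul
      (hg z hz)).congr_of_mem hz hf
    rw [Function.iterate_succ_apply', h.radialLie_eq, radialSpeed_eq hz.1]
    simp only [Pi.add_apply, Pi.smul_apply, Pi.mul_apply, smul_eq_mul]
    push_cast
    ring

lemma hasRadialDeriv_iterate (k : ℕ) {z : ℝ × ℝ} (hz : z ∈ radialDomain) :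
    HasRadialDeriv (radialLie^[k] radialLog) (radialLie^[k + 1] radialLog z) z := by
  suffices h : ∃ d, HasRadialDeriv (radialLie^[k] radialLog) d z by
    obtain ⟨d, h⟩ := h
    rwa [Function.iterate_succ_apply', h.radialLie_eq]
  cases k with
  | zero => exact ⟨_, hasRadialDeriv_radialLog hz⟩
  | succ k =>
    obtain ⟨f, hfm, hf⟩ := exists_iterate_radialLie_eq k
    obtain ⟨g, -, hg⟩ := exists_hasRadialDeriv_of_mem hfm
    exact ⟨_, ((HasRadialDeriv.snd.comp (hasDerivAt_pow (k + 2) z.2)).mul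
      (hg z hz)).congr_of_mem hz hf⟩

lemma LieD_comp_radial {ν : ℝ} (hν : 0 < ν) {f : ℝ × ℝ → ℝ} {d t x y : ℝ}
    (hA : 0 < x ^ 2 + y ^ 2)
    (hf : HasRadialDeriv f d (t, ν * (x ^ 2 + y ^ 2))) :
    LieD ν (fun z => 1 / ν * f (z.1, ν * (z.2.1 ^ 2 + z.2.2 ^ 2))) (t, x, y) = 1 / ν * d := by
  obtain ⟨f', hf', rfl⟩ := hf
  have hx : HasFDerivAt (fun z : ℝ × ℝ × ℝ => z.2.1)
      ((ContinuousLinearMap.fst ℝ ℝ ℝ).comp (ContinuousLinearMap.snd ℝ ℝ (ℝ × ℝ))) (t, x, y) :=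
    hasFDerivAt_fst.comp (t, x, y) hasFDerivAt_snd
  have hy : HasFDerivAt (fun z : ℝ × ℝ × ℝ => z.2.2)
      ((ContinuousLinearMap.snd ℝ ℝ ℝ).comp (ContinuousLinearMap.snd ℝ ℝ (ℝ × ℝ))) (t, x, y) :=
    hasFDerivAt_snd.comp (t, x, y) hasFDerivAt_snd
  have hA' : HasFDerivAt (fun z : ℝ × ℝ × ℝ => z.2.1 ^ 2 + z.2.2 ^ 2) _ (t, x, y) :=
    (hx.pow 2).add (hy.pow 2)
  have hr := (hasFDerivAt_fst (𝕜 := ℝ) (p := ((t, x, y) : ℝ × ℝ × ℝ))).prodMk (hA'.const_mul ν)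
  have h : HasFDerivAt (fun z : ℝ × ℝ × ℝ => 1 / ν * f (z.1, ν * (z.2.1 ^ 2 + z.2.2 ^ 2))) _
      (t, x, y) := (HasFDerivAt.comp (g := f) (t, x, y) hf' hr).const_mul (1 / ν)
  rw [LieD, h.fderiv]
  simp only [smul_apply, ContinuousLinearMap.comp_apply, smul_eq_mul]
  congr 2
  refine Prod.ext rfl ?_
  simp [radialSpeed, chi, hA.ne']
  rw [show 1 + t * (ν * (x ^ 2 + y ^ 2)) = 1 + t * ν * (x ^ 2 + y ^ 2) by ring]
  generalize 1 + t * ν * (x ^ 2 + y ^ 2) = b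
  field_simp

lemma iterate_LieD_eq {ν : ℝ} (hν : 0 < ν) (k : ℕ) {t x y : ℝ} (hA : 0 < x ^ 2 + y ^ 2)
    (ht : 0 < 1 + t * (ν * (x ^ 2 + y ^ 2))) :
    (LieD ν)^[k] (Ptilde ν) (t, x, y)
      = 1 / ν * radialLie^[k] radialLog (t, ν * (x ^ 2 + y ^ 2)) := by
  induction k generalizing t x y with
  | zero =>
    simp only [Function.iterate_zero, id, Ptilde, radialLog]
    ring
  | succ k ih =>
    have hz : (t, ν * (x ^ 2 + y ^ 2)) ∈ radialDomain := ⟨mul_pos hν hA, ht⟩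
    rw [Function.iterate_succ_apply', ← LieD_comp_radial hν hA (hasRadialDeriv_iterate k hz)]
    unfold LieD
    congr 1
    apply Filter.EventuallyEq.fderiv_eq
    have h1 : ∀ᶠ z : ℝ × ℝ × ℝ in nhds (t, x, y), 0 < z.2.1 ^ 2 + z.2.2 ^ 2 :=
      (isOpen_lt continuous_const (by fun_prop)).mem_nhds hA
    have h2 : ∀ᶠ z : ℝ × ℝ × ℝ in nhds (t, x, y),
        0 < 1 + z.1 * (ν * (z.2.1 ^ 2 + z.2.2 ^ 2)) :=
      (isOpen_lt continuous_const (by fun_prop)).mem_nhds ht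
    filter_upwards [h1, h2] with z hz1 hz2 using ih hz1 hz2

lemma iterate_LieD_origin (ν : ℝ) (k : ℕ) (t : ℝ) :
    (LieD ν)^[k] (Ptilde ν) (t, 0, 0) = 0 := by
  induction k generalizing t with
  | zero => simp [Ptilde]
  | succ k ih =>
    rw [Function.iterate_succ_apply', LieD]
    by_cases hd : DifferentiableAt ℝ ((LieD ν)^[k] (Ptilde ν)) (t, 0, 0)
    · have h1 : HasDerivAt (fun s : ℝ => ((s, 0, 0) : ℝ × ℝ × ℝ)) (1, 0, 0) t :=
        (hasDerivAt_id t).prodMk ((hasDerivAt_const t 0).prodMk (hasDerivAt_const t 0))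
      have h2 := hd.hasFDerivAt.comp_hasDerivAt t h1
      have h3 : HasDerivAt ((LieD ν)^[k] (Ptilde ν) ∘ fun s : ℝ => ((s, 0, 0) : ℝ × ℝ × ℝ)) 0 t := by
        rw [show ((LieD ν)^[k] (Ptilde ν) ∘ fun s : ℝ => ((s, 0, 0) : ℝ × ℝ × ℝ))
          = fun _ => (0 : ℝ) from funext ih]
        exact hasDerivAt_const t 0
      simpa using h2.unique h3
    · simp [fderiv_zero_of_not_differentiableAt hd]

/-- The time at which the integral curve through `(1, w)` reaches `u`. -/
noncomputable def arrivalTime (w u : ℝ) : ℝ :=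
  (w - Real.log (1 + u)) / (u - Real.log (1 + u))

lemma log_one_add_lt {u : ℝ} (hu : 0 < u) : Real.log (1 + u) < u := by
  linarith [Real.log_lt_sub_one_of_pos (show 0 < 1 + u by linarith) (by linarith)]

lemma radialSpeed_ne_zero {z : ℝ × ℝ} (hz : z ∈ radialDomain) : radialSpeed z ≠ 0 :=
  mul_ne_zero (div_ne_zero (by linarith [hz.1]) hz.2.ne')
    (sub_ne_zero.2 (log_one_add_lt hz.1).ne)

lemma hasDerivAt_arrivalTime {w u : ℝ} (hu : 0 < u) :
    HasDerivAt (arrivalTime w) (radialSpeed (arrivalTime w u, u))⁻¹ u := by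
  have hl := log_one_add_lt hu
  have hl' : u - Real.log (1 + u) ≠ 0 := by linarith
  have h0 : (1 : ℝ) + u ≠ 0 := by positivity
  have h1 : HasDerivAt (fun u : ℝ => Real.log (1 + u)) (1 / (1 + u)) u :=
    ((hasDerivAt_id u).const_add 1).log h0
  have h : HasDerivAt (arrivalTime w) _ u :=
    (h1.const_sub w).div ((hasDerivAt_id u).sub h1) hl'
  convert h using 1
  have e : 1 + arrivalTime w u * u
      = ((u - Real.log (1 + u)) + (w - Real.log (1 + u)) * u) / (u - Real.log (1 + u)) := by
    rw [arrivalTime]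
    field_simp
  simp only [radialSpeed]
  rw [mul_inv, inv_div, e,
    show Real.log (1 + u) - u = -(u - Real.log (1 + u)) by ring, inv_neg]
  field_simp
  ring

lemma hasDerivAt_lieSum {w u : ℝ} (hu : 0 < u) (hT : 0 < 1 + arrivalTime w u * u) (K : ℕ) :
    HasDerivAt (fun u => ∑ k ∈ Finset.range (K + 1), (-arrivalTime w u) ^ k / k.factorial *
        radialLie^[k] radialLog (arrivalTime w u, u))
      ((radialSpeed (arrivalTime w u, u))⁻¹ * ((-arrivalTime w u) ^ K / K.factorial *
        radialLie^[K + 1] radialLog (arrivalTime w u, u))) u := by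
  have hdT := hasDerivAt_arrivalTime (w := w) hu
  have hne : radialSpeed (arrivalTime w u, u) ≠ 0 := radialSpeed_ne_zero ⟨hu, hT⟩
  have hG : ∀ k : ℕ, HasDerivAt (fun u => radialLie^[k] radialLog (arrivalTime w u, u))
      ((radialSpeed (arrivalTime w u, u))⁻¹ *
        radialLie^[k + 1] radialLog (arrivalTime w u, u)) u := by
    intro k
    obtain ⟨f', hf', hd⟩ := hasRadialDeriv_iterate k (z := (arrivalTime w u, u)) ⟨hu, hT⟩
    refine (HasFDerivAt.comp_hasDerivAt (f := fun u => (arrivalTime w u, u)) u hf'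
      (hdT.prodMk (hasDerivAt_id u))).congr_deriv ?_
    rw [← hd, ← smul_eq_mul, ← map_smul]
    simp [hne]
  induction K with
  | zero => simpa using hG 0
  | succ K ih =>
    simp_rw [Finset.sum_range_succ _ (K + 1)]
    refine (ih.add (((hdT.neg.pow (K + 1)).div_const ((K + 1).factorial : ℝ)).mul
      (hG (K + 1)))).congr_deriv ?_
    simp only [Pi.neg_apply, Pi.pow_apply, Nat.add_sub_cancel]
    have : (K.factorial : ℝ) ≠ 0 := by positivity
    rw [Nat.factorial_succ]
    push_cast
    field_simp
    ring

/-- Mean value form of the remainder of the Lie series in the variables `(t, u)`. -/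
lemma exists_lieSum_remainder {w : ℝ} (hw : 0 < w) (hw1 : w ≤ 1) (K : ℕ) :
    ∃ t u : ℝ, 0 ≤ t ∧ t ≤ 1 ∧ 0 < u ∧ u ≤ 2 * w ∧
      ∑ k ∈ Finset.range (K + 1), (-1) ^ k / k.factorial * radialLie^[k] radialLog (1, w) - w / 2
        = (-t) ^ K / K.factorial * radialLie^[K + 1] radialLog (t, u) := by
  have hlt : w < Real.exp w - 1 := by linarith [Real.add_one_lt_exp hw.ne']
  have hle : Real.exp w - 1 ≤ 2 * w := by
    have := (abs_le.1 (Real.abs_exp_sub_one_sub_id_le (x := w) (by rwa [abs_of_pos hw]))).2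
    nlinarith
  have hT : ∀ u ∈ Set.Icc w (Real.exp w - 1), 0 < u ∧ 0 ≤ arrivalTime w u ∧ arrivalTime w u ≤ 1 ∧
      0 < 1 + arrivalTime w u * u := by
    intro u hu
    have hu0 : 0 < u := hw.trans_le hu.1
    have hl := log_one_add_lt hu0
    have hlw : Real.log (1 + u) ≤ w := by
      rw [Real.log_le_iff_le_exp (by linarith)]
      linarith [hu.2]
    have h0 : 0 ≤ arrivalTime w u := div_nonneg (by linarith) (by linarith)
    have h1 : arrivalTime w u ≤ 1 := by
      rw [arrivalTime, div_le_one (by linarith)]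
      linarith [hu.1]
    exact ⟨hu0, h0, h1, by positivity⟩
  have hdS := fun u hu => hasDerivAt_lieSum (hT u hu).1 (hT u hu).2.2.2 K
  have hdT := fun u hu => hasDerivAt_arrivalTime (w := w) (hT u hu).1
  obtain ⟨c, hc, h⟩ := exists_ratio_hasDerivAt_eq_ratio_slope _ _ hlt
    (fun u hu => (hdS u hu).continuousAt.continuousWithinAt)
    (fun u hu => hdS u (Set.Ioo_subset_Icc_self hu)) _ _
    (fun u hu => (hdT u hu).continuousAt.continuousWithinAt)
    (fun u hu => hdT u (Set.Ioo_subset_Icc_self hu))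
  obtain ⟨hc0, ht0, ht1, htc⟩ := hT c (Set.Ioo_subset_Icc_self hc)
  have hTw : arrivalTime w w = 1 := div_self (by linarith [log_one_add_lt hw])
  have hTe : arrivalTime w (Real.exp w - 1) = 0 := by simp [arrivalTime]
  have hne : radialSpeed (arrivalTime w c, c) ≠ 0 := radialSpeed_ne_zero ⟨hc0, htc⟩
  refine ⟨arrivalTime w c, c, ht0, ht1, hc0, hc.2.le.trans hle, ?_⟩
  have hend : ∑ k ∈ Finset.range (K + 1), (-(0 : ℝ)) ^ k / k.factorial *
      radialLie^[k] radialLog (0, Real.exp w - 1) = w / 2 := by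
    rw [Finset.sum_range_succ']
    simp [radialLog]
  rw [hTw, hTe, hend] at h
  field_simp at h ⊢
  linarith

/-- Convergence rate of the truncated Lie series of `P`: for each `K ≥ 1` there are
`C, c > 0` such that for all `ν > 0` and `ρ > 0` with `νρ² ≤ c`, on `{x²+y² ≤ ρ²}`,
`|(x²+y²)/2 − Σ_{k=0}^{K} ((−1)^k/k!)·(LᵏP̃)(1,x,y)| ≤ C·ν^{K+1}·ρ^{2K+4}`. -/
theorem stmt17 (K : ℕ) (hK : 1 ≤ K) :
    ∃ C > (0 : ℝ), ∃ c > (0 : ℝ), ∀ ν : ℝ, 0 < ν → ∀ ρ : ℝ, 0 < ρ → ν * ρ ^ 2 ≤ c →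
      ∀ x y : ℝ, x ^ 2 + y ^ 2 ≤ ρ ^ 2 →
        |(x ^ 2 + y ^ 2) / 2 -
            ∑ k ∈ Finset.range (K + 1),
              ((-1 : ℝ) ^ k / (Nat.factorial k)) * ((LieD ν)^[k] (Ptilde ν) (1, x, y))|
          ≤ C * ν ^ (K + 1) * ρ ^ (2 * K + 4) := by
  obtain ⟨f, hfm, hf⟩ := exists_iterate_radialLie_eq K
  obtain ⟨C, hC, hfC⟩ := exists_abs_le_of_mem hfm
  refine ⟨2 ^ (K + 2) * (C + 1), by positivity, 1, one_pos, fun ν hν ρ hρ hνρ x y hxy => ?_⟩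
  rcases (add_nonneg (sq_nonneg x) (sq_nonneg y)).eq_or_lt with hA | hA
  · have hx : x = 0 := by nlinarith [sq_nonneg x, sq_nonneg y]
    have hy : y = 0 := by nlinarith [sq_nonneg x, sq_nonneg y]
    subst hx hy
    simp only [iterate_LieD_origin]
    simp only [mul_zero, Finset.sum_const_zero]
    norm_num
    positivity
  set w := ν * (x ^ 2 + y ^ 2) with hw
  have hw0 : 0 < w := mul_pos hν hA
  have hwρ : w ≤ ν * ρ ^ 2 := mul_le_mul_of_nonneg_left hxy hν.le
  obtain ⟨t, u, ht0, ht1, hu0, hu2, h⟩ := exists_lieSum_remainder hw0 (hwρ.trans hνρ) K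
  have hsum : (x ^ 2 + y ^ 2) / 2 - ∑ k ∈ Finset.range (K + 1),
      ((-1 : ℝ) ^ k / (Nat.factorial k)) * ((LieD ν)^[k] (Ptilde ν) (1, x, y))
      = -(1 / ν * ((-t) ^ K / K.factorial * radialLie^[K + 1] radialLog (t, u))) := by
    rw [← h, mul_sub, Finset.mul_sum, hw]
    simp_rw [iterate_LieD_eq hν _ hA (show 0 < 1 + 1 * (ν * (x ^ 2 + y ^ 2)) by linarith)]
    rw [neg_sub]
    congr 1
    · field_simp
    · exact Finset.sum_congr rfl fun k _ => by ring
  have htK : |(-t) ^ K / K.factorial| ≤ 1 := by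
    rw [abs_div, abs_pow, abs_neg, abs_of_nonneg ht0, Nat.abs_cast, div_le_one (by positivity)]
    exact (pow_le_one₀ ht0 ht1).trans (by exact_mod_cast K.factorial_pos)
  have hu : u ≤ 2 * (ν * ρ ^ 2) := by linarith
  have hrem : |radialLie^[K + 1] radialLog (t, u)| ≤ (2 * (ν * ρ ^ 2)) ^ (K + 2) * (C + 1) := by
    rw [hf (t, u) ⟨hu0, by positivity⟩, abs_mul, abs_pow, abs_of_pos hu0]
    have := hfC t u ht0 ht1 hu0 (by linarith)
    gcongr
    linarith
  rw [hsum, abs_neg, abs_mul, abs_mul, abs_of_pos (by positivity : 0 < 1 / ν)]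
  calc 1 / ν * (|(-t) ^ K / K.factorial| * |radialLie^[K + 1] radialLog (t, u)|)
      ≤ 1 / ν * (1 * ((2 * (ν * ρ ^ 2)) ^ (K + 2) * (C + 1))) := by gcongr
    _ = 2 ^ (K + 2) * (C + 1) * ν ^ (K + 1) * ρ ^ (2 * K + 4) := by
      rw [mul_pow, mul_pow, ← pow_mul, show 2 * (K + 2) = 2 * K + 4 by ring, pow_succ ν (K + 1)]
      field_simp
end

section
/- The quantity P is a conserved quantity of the Salerno model with respect to its non-standard Poisson structure: for every (q,p) ∈ ℝ^N×ℝ^N, the non-standard Poisson bracket {H, P}(q,p) = Σ_j (1+ν(q_j²+p_j²))·(∂H/∂q_j · ∂P/∂p_j − ∂H/∂p_j · ∂P/∂q_j)(q,p) vanishes. -/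
/-- The Salerno Hamiltonian in Cartesian coordinates on the periodic lattice `ℤ/N`. -/
noncomputable def salernoH (ν γ ε : ℝ) (N : ℕ) [NeZero N] (q p : ZMod N → ℝ) : ℝ :=
  (∑ j : ZMod N, (-(γ / (4 * ν ^ 2)) * Real.log (1 + ν * ((q j) ^ 2 + (p j) ^ 2))
      + γ / (4 * ν) * ((q j) ^ 2 + (p j) ^ 2)))
  + ε * ∑ j : ZMod N, (q (j + 1) * q j + p (j + 1) * p j)

/-- The conserved quantity `P(q,p) = (1/(2ν))·Σ_j ln(1+ν(q_j²+p_j²))`. -/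
noncomputable def Pquant (ν : ℝ) (N : ℕ) [NeZero N] (q p : ZMod N → ℝ) : ℝ :=
  (1 / (2 * ν)) * ∑ j : ZMod N, Real.log (1 + ν * ((q j) ^ 2 + (p j) ^ 2))

/-- Partial derivative of `F` with respect to `q_j`. -/
noncomputable def pdq {N : ℕ} [NeZero N] (F : (ZMod N → ℝ) → (ZMod N → ℝ) → ℝ)
    (j : ZMod N) (q p : ZMod N → ℝ) : ℝ :=
  deriv (fun s => F (Function.update q j s) p) (q j)

/-- Partial derivative of `F` with respect to `p_j`. -/
noncomputable def pdp {N : ℕ} [NeZero N] (F : (ZMod N → ℝ) → (ZMod N → ℝ) → ℝ)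
    (j : ZMod N) (q p : ZMod N → ℝ) : ℝ :=
  deriv (fun s => F q (Function.update p j s)) (p j)

theorem hasDerivAt_update_apply {ι : Type*} [DecidableEq ι] (q : ι → ℝ) (j k : ι) (s : ℝ) :
    HasDerivAt (fun s => Function.update q j s k) (if k = j then 1 else 0) s := by
  by_cases h : k = j
  · subst h
    simpa using hasDerivAt_id' s
  · simpa [h] using hasDerivAt_const s (q k)

theorem one_add_mul_sq_add_sq_pos {ν : ℝ} (hν : 0 < ν) (x y : ℝ) :
    0 < 1 + ν * (x ^ 2 + y ^ 2) := by positivity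

theorem hasDerivAt_log_update {ι : Type*} [DecidableEq ι] {ν : ℝ} (hν : 0 < ν) (q p : ι → ℝ)
    (j k : ι) :
    HasDerivAt (fun s => Real.log (1 + ν * ((Function.update q j s k) ^ 2 + (p k) ^ 2)))
      (if k = j then 2 * ν * q k / (1 + ν * ((q k) ^ 2 + (p k) ^ 2)) else 0) (q j) := by
  have h := (((((hasDerivAt_update_apply q j k (q j)).fun_pow 2).add_const
    ((p k) ^ 2)).const_mul ν).const_add 1).log (one_add_mul_sq_add_sq_pos hν _ _).ne'
  simp only [Function.update_eq_self] at h
  convert h using 1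
  split_ifs <;> simp
  ring

theorem pdq_Pquant {ν : ℝ} (hν : 0 < ν) {N : ℕ} [NeZero N] (q p : ZMod N → ℝ) (j : ZMod N) :
    pdq (Pquant ν N) j q p = q j / (1 + ν * ((q j) ^ 2 + (p j) ^ 2)) := by
  have h := (HasDerivAt.fun_sum (u := Finset.univ)
    fun k _ => hasDerivAt_log_update hν q p j k).const_mul (1 / (2 * ν))
  refine h.deriv.trans ?_
  rw [Finset.sum_ite_eq' Finset.univ j, if_pos (Finset.mem_univ j)]
  field_simp

theorem pdq_salernoH {ν : ℝ} (hν : 0 < ν) (γ ε : ℝ) {N : ℕ} [NeZero N] (q p : ZMod N → ℝ)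
    (j : ZMod N) :
    pdq (salernoH ν γ ε N) j q p =
      (-(γ / (4 * ν ^ 2)) * (2 * ν * q j / (1 + ν * ((q j) ^ 2 + (p j) ^ 2)))
        + γ / (4 * ν) * (2 * q j)) + ε * (q (j - 1) + q (j + 1)) := by
  have hu := fun k => hasDerivAt_update_apply q j k (q j)
  have h := (HasDerivAt.fun_sum (u := Finset.univ) fun k _ =>
      ((hasDerivAt_log_update hν q p j k).const_mul (-(γ / (4 * ν ^ 2)))).fun_add
        ((((hu k).fun_pow 2).add_const ((p k) ^ 2)).const_mul (γ / (4 * ν)))).fun_add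
    ((HasDerivAt.fun_sum (u := Finset.univ) fun k _ =>
      ((hu (k + 1)).fun_mul (hu k)).add_const (p (k + 1) * p k)).const_mul ε)
  refine h.deriv.trans ?_
  simp only [Function.update_eq_self]
  simp [Finset.sum_add_distrib, ← eq_sub_iff_add_eq]

theorem pdp_eq_pdq_swap {N : ℕ} [NeZero N] {F : (ZMod N → ℝ) → (ZMod N → ℝ) → ℝ}
    (hF : ∀ q p, F q p = F p q) (j : ZMod N) (q p : ZMod N → ℝ) :
    pdp F j q p = pdq F j p q := by
  simp only [pdp, pdq, hF q]

theorem Pquant_swap (ν : ℝ) (N : ℕ) [NeZero N] (q p : ZMod N → ℝ) :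
    Pquant ν N q p = Pquant ν N p q := by
  simp only [Pquant, add_comm]

theorem salernoH_swap (ν γ ε : ℝ) (N : ℕ) [NeZero N] (q p : ZMod N → ℝ) :
    salernoH ν γ ε N q p = salernoH ν γ ε N p q := by
  simp only [salernoH, add_comm ((q _) ^ 2), add_comm (q _ * q _)]

/-- `P` is a conserved quantity of the Salerno model: the non-standard Poisson
bracket `{H, P} = Σ_j (1+ν(q_j²+p_j²))·(∂H/∂q_j·∂P/∂p_j − ∂H/∂p_j·∂P/∂q_j)`
vanishes at every `(q,p)`. -/
theorem stmt19 (ν γ ε : ℝ) (hν : 0 < ν) (N : ℕ) [NeZero N] (hN : 2 ≤ N)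
    (q p : ZMod N → ℝ) :
    ∑ j : ZMod N, (1 + ν * ((q j) ^ 2 + (p j) ^ 2)) *
      (pdq (fun q' p' => salernoH ν γ ε N q' p') j q p *
          pdp (fun q' p' => Pquant ν N q' p') j q p -
        pdp (fun q' p' => salernoH ν γ ε N q' p') j q p *
          pdq (fun q' p' => Pquant ν N q' p') j q p) = 0 := by
  have hterm : ∀ j : ZMod N, (1 + ν * ((q j) ^ 2 + (p j) ^ 2)) *
      (pdq (salernoH ν γ ε N) j q p * pdp (Pquant ν N) j q p -
        pdp (salernoH ν γ ε N) j q p * pdq (Pquant ν N) j q p) =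
      ε * ((q (j - 1) * p j - p (j - 1) * q j) - (q j * p (j + 1) - p j * q (j + 1))) := by
    intro j
    rw [pdp_eq_pdq_swap (Pquant_swap ν N), pdp_eq_pdq_swap (salernoH_swap ν γ ε N),
      pdq_Pquant hν, pdq_Pquant hν, pdq_salernoH hν, pdq_salernoH hν, add_comm ((p j) ^ 2)]
    have hpos := (one_add_mul_sq_add_sq_pos hν (q j) (p j)).ne'
    generalize 1 + ν * ((q j) ^ 2 + (p j) ^ 2) = d at hpos ⊢
    field_simp
    ring
  have hshift := Equiv.sum_comp (Equiv.addRight (1 : ZMod N))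
    fun j => q (j - 1) * p j - p (j - 1) * q j
  simp only [Equiv.coe_addRight, add_sub_cancel_right] at hshift
  refine (Finset.sum_congr rfl fun j _ => hterm j).trans ?_
  rw [← Finset.mul_sum, Finset.sum_sub_distrib, ← hshift]
  simp
end
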